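/- Let M be an internally 4-connected binary matroid in which every element is in exactly three triangles and whose ground set has at least 14 elements, and suppose M has no 4-element cocircuit. If every exact 4-separation of M is sequential, then, for every element e of M, the matroid si(M/e) is internally 4-connected and has no triads. -/

import Mathlib

open Set Matroid

namespace Paper

variable {α : Type*}

/-- A circuit of a matroid: a minimal dependent set. -/
def Circuit (M : Matroid α) (C : Set α) : Prop :=
  C ⊆ M.E ∧ ¬ M.Indep C ∧ ∀ D, D ⊂ C → M.Indep D

/-- A cocircuit: a circuit of the dual matroid. -/
def Cocircuit (M : Matroid α) (C : Set α) : Prop := Circuit M✶ C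

/-- A triangle: a 3-element circuit. -/
def IsTriangle (M : Matroid α) (T : Set α) : Prop := Circuit M T ∧ T.encard = 3

/-- A triad: a 3-element cocircuit. -/
def IsTriad (M : Matroid α) (T : Set α) : Prop := Cocircuit M T ∧ T.encard = 3

/-- The (extended) rank of a set: the supremum of the cardinalities of
independent subsets. -/
noncomputable def eRank (M : Matroid α) (X : Set α) : ℕ∞ :=
  ⨆ I ∈ {I : Set α | M.Indep I ∧ I ⊆ X}, I.encard

/-- The rank of the matroid. -/
noncomputable def eRk (M : Matroid α) : ℕ∞ := eRank M M.E

/-- `(X, Y)` is a `k`-separation of `M`: a partition of the ground set into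
two sets, each of size at least `k`, with `λ(X) = r(X) + r(Y) - r(M) ≤ k - 1`. -/
def IsKSeparation (M : Matroid α) (k : ℕ) (X Y : Set α) : Prop :=
  Disjoint X Y ∧ X ∪ Y = M.E ∧
    eRank M X + eRank M Y ≤ eRk M + ((k - 1 : ℕ) : ℕ∞) ∧
    (k : ℕ∞) ≤ X.encard ∧ (k : ℕ∞) ≤ Y.encard

/-- `M` is `n`-connected if it has no `k`-separation for any positive `k < n`. -/
def NConnected (M : Matroid α) (n : ℕ) : Prop :=
  ∀ k, 1 ≤ k → k < n → ∀ X Y, ¬ IsKSeparation M k X Y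

/-- `M` is internally 4-connected if it is 3-connected and every
3-separation has a side that is a triangle or a triad. -/
def InternallyFourConnected (M : Matroid α) : Prop :=
  NConnected M 3 ∧ ∀ X Y, IsKSeparation M 3 X Y →
    IsTriangle M X ∨ IsTriad M X ∨ IsTriangle M Y ∨ IsTriad M Y

/-- `M` is binary: representable over `GF(2)`. -/
def Binary (M : Matroid α) : Prop :=
  ∃ φ : α → (α →₀ ZMod 2), ∀ I, I ⊆ M.E →
    (M.Indep I ↔ LinearIndependent (ZMod 2) (fun x : I => φ x.1))

/-- Every element of `M` is in exactly three triangles. -/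
def EveryElementInThreeTriangles (M : Matroid α) : Prop :=
  ∀ e ∈ M.E, {T : Set α | IsTriangle M T ∧ e ∈ T}.encard = 3

/-- Deletion of a set of elements. -/
def delete (M : Matroid α) (D : Set α) : Matroid α := M ↾ (M.E \ D)

/-- Contraction of a set of elements. -/
def contract (M : Matroid α) (C : Set α) : Matroid α := (delete M✶ C)✶

/-- A nonloop. -/
def Nonloop (M : Matroid α) (e : α) : Prop := M.Indep {e}

/-- `N` is a simplification of `M`: the restriction of `M` to a set of
nonloops containing exactly one element from each parallel class. -/
def IsSimplificationOf (N M : Matroid α) : Prop :=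
  ∃ S, S ⊆ M.E ∧ N = M ↾ S ∧ (∀ e ∈ S, Nonloop M e) ∧
    ∀ f, Nonloop M f → ∃! e, e ∈ S ∧ M.closure {e} = M.closure {f}

/-- `si(M/e)` is internally 4-connected. -/
def SiContractI4C (M : Matroid α) (e : α) : Prop :=
  ∀ N, IsSimplificationOf N (contract M {e}) → InternallyFourConnected N

/-- A set is fully closed if it is closed in `M` and in `M✶`. -/
def FullyClosed (M : Matroid α) (F : Set α) : Prop :=
  M.closure F = F ∧ M✶.closure F = F

/-- The full closure of a set: the intersection of all fully closed sets
containing it. -/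
def fcl (M : Matroid α) (Z : Set α) : Set α := ⋂₀ {F | Z ⊆ F ∧ FullyClosed M F}

/-- An exact 4-separation: a 4-separation with `λ = 3`. -/
def IsExact4Separation (M : Matroid α) (X Y : Set α) : Prop :=
  Disjoint X Y ∧ X ∪ Y = M.E ∧
    eRank M X + eRank M Y = eRk M + 3 ∧
    (4 : ℕ∞) ≤ X.encard ∧ (4 : ℕ∞) ≤ Y.encard

abbrev VV (α : Type*) := α →₀ ZMod 2

def Rep (M : Matroid α) (φ : α → VV α) : Prop :=
  ∀ I, I ⊆ M.E → (M.Indep I ↔ LinearIndepOn (ZMod 2) φ I)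

lemma eRank_eq (M : Matroid α) (X : Set α) : eRank M X = M.eRk X := by
  unfold eRank
  apply le_antisymm
  · refine iSup₂_le fun I hI => hI.1.encard_le_eRk_of_subset hI.2
  · obtain ⟨I, hI⟩ := M.exists_isBasis' X
    rw [hI.eRk_eq_encard]
    exact le_iSup₂_of_le I ⟨hI.indep, hI.subset⟩ le_rfl

lemma eRk_eq (M : Matroid α) : Paper.eRk M = M.eRk M.E := eRank_eq M M.E

lemma contract_eq (M : Matroid α) (C : Set α) : contract M C = M ／ C := rfl

lemma Rep.mem_span_indep {M : Matroid α} {φ : α → VV α} (h : Rep M φ) {I : Set α} {x : α}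
    (hI : M.Indep I) (hx : x ∈ M.E) :
    x ∈ M.closure I ↔ φ x ∈ Submodule.span (ZMod 2) (φ '' I) := by
  have hIE := hI.subset_ground
  rw [((h I hIE).1 hI).mem_span_iff, hI.mem_closure_iff',
    h (insert x I) (insert_subset hx hIE)]
  simp [hx]

lemma Rep.span_basis {M : Matroid α} {φ : α → VV α} (h : Rep M φ) {I X : Set α}
    (hI : M.IsBasis I X) :
    Submodule.span (ZMod 2) (φ '' I) = Submodule.span (ZMod 2) (φ '' X) := by
  apply le_antisymm
  · exact Submodule.span_mono (image_mono hI.subset)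
  · rw [Submodule.span_le]
    rintro _ ⟨x, hx, rfl⟩
    exact (h.mem_span_indep hI.indep (hI.subset_ground hx)).1 (hI.subset_closure hx)

lemma Rep.mem_span {M : Matroid α} {φ : α → VV α} (h : Rep M φ) {X : Set α} {x : α}
    (hX : X ⊆ M.E) (hx : x ∈ M.E) :
    x ∈ M.closure X ↔ φ x ∈ Submodule.span (ZMod 2) (φ '' X) := by
  obtain ⟨I, hI⟩ := M.exists_isBasis X
  rw [← hI.closure_eq_closure, h.mem_span_indep hI.indep hx, h.span_basis hI]

lemma Rep.span_card {M : Matroid α} {φ : α → VV α} (h : Rep M φ) {X : Set α} {n : ℕ}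
    (hX : X ⊆ M.E) (hn : M.eRk X ≤ n) :
    ((Submodule.span (ZMod 2) (φ '' X) : Submodule (ZMod 2) (VV α)) : Set (VV α)).encard
      ≤ ((2 ^ n : ℕ) : ℕ∞) := by
  classical
  obtain ⟨I, hI⟩ := M.exists_isBasis X
  rw [hI.eRk_eq_encard] at hn
  have hfin : I.Finite := finite_of_encard_le_coe hn
  rw [← h.span_basis hI]
  set W := Submodule.span (ZMod 2) (φ '' I) with hW
  have hfi : (φ '' I).Finite := hfin.image _
  have : Module.Finite (ZMod 2) W := Module.Finite.span_of_finite _ hfi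
  have : Finite W := Module.finite_of_finite (ZMod 2)
  have h1 : Module.finrank (ZMod 2) W ≤ n := by
    have := hfi.fintype
    have h2 := finrank_span_le_card (R := ZMod 2) (φ '' I)
    have h3 : ((φ '' I).toFinset.card : ℕ∞) ≤ n := by
      rw [← Set.encard_coe_eq_coe_finsetCard, Set.coe_toFinset]
      exact (encard_image_le _ _).trans hn
    have h4 : (φ '' I).toFinset.card ≤ n := by exact_mod_cast h3
    exact h2.trans h4
  have h5 : Nat.card W = 2 ^ Module.finrank (ZMod 2) W := by
    have := Module.natCard_eq_pow_finrank (K := ZMod 2) (V := W)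
    simpa using this
  have h6 : (W : Set (VV α)).encard = ((Nat.card W : ℕ) : ℕ∞) := by
    have : (W : Set (VV α)).Finite := Set.toFinite _
    rw [← this.cast_ncard_eq]; rfl
  rw [h6, h5]
  exact_mod_cast Nat.pow_le_pow_right (by norm_num) h1

lemma Rep.functional {M : Matroid α} {φ : α → VV α} (h : Rep M φ) {X : Set α} {z : α}
    (hX : X ⊆ M.E) (hz : z ∈ M.E) (hzX : z ∉ M.closure X) :
    ∃ f : VV α →ₗ[ZMod 2] ZMod 2, f (φ z) = 1 ∧ ∀ x ∈ X, f (φ x) = 0 := by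
  rw [h.mem_span hX hz] at hzX
  obtain ⟨f, hf, hf'⟩ := Submodule.exists_dual_map_eq_bot_of_notMem hzX inferInstance
  have key : ∀ a : ZMod 2, a ≠ 0 → a = 1 := by decide
  refine ⟨f, key _ hf, fun x hx => ?_⟩
  have : f (φ x) ∈ (Submodule.span (ZMod 2) (φ '' X)).map f :=
    Submodule.mem_map_of_mem (Submodule.subset_span (mem_image_of_mem _ hx))
  rw [hf'] at this
  simpa using this

/-- Consequences of 3-connectivity. -/
lemma rank_fin {M : Matroid α} (h : NConnected M 3) (hE : (14 : ℕ∞) ≤ M.E.encard) :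
    M.eRk M.E ≠ ⊤ := by
  intro htop
  have hne : M.E.Nonempty := by
    rw [← encard_pos]; exact lt_of_lt_of_le (by norm_num) hE
  obtain ⟨x, hx⟩ := hne
  refine h 1 le_rfl (by norm_num) {x} (M.E \ {x}) ⟨disjoint_sdiff_right, ?_, ?_, ?_, ?_⟩
  · exact union_sdiff_cancel (by simpa using hx)
  · rw [eRk_eq, htop]; simp
  · simp
  · have := encard_sdiff_singleton_add_one hx
    rw [← this] at hE
    by_contra hlt
    push Not at hlt
    have h0 : (M.E \ {x}).encard = 0 := by
      simpa using hlt
    rw [h0] at hE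
    norm_num at hE

lemma pair_indep {M : Matroid α} (h : NConnected M 3) (hE : (14 : ℕ∞) ≤ M.E.encard)
    {x y : α} (hx : x ∈ M.E) (hy : y ∈ M.E) (hxy : x ≠ y) : M.Indep {x, y} := by
  by_contra hd
  have hss : ({x, y} : Set α) ⊆ M.E := by
    rintro z (rfl | rfl) <;> assumption
  have hc : ({x, y} : Set α).encard = 2 := encard_pair hxy
  have hlt : M.eRk {x, y} < ({x, y} : Set α).encard :=
    eRk_lt_encard_of_dep_of_finite (by simp) ⟨hd, hss⟩
  have hle : M.eRk {x, y} ≤ 1 := by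
    rw [hc] at hlt
    exact Order.le_of_lt_add_one (by simpa [one_add_one_eq_two] using hlt)
  refine h 2 (by norm_num) (by norm_num) {x, y} (M.E \ {x, y}) ⟨disjoint_sdiff_right, ?_, ?_, ?_, ?_⟩
  · exact union_sdiff_cancel hss
  · rw [eRk_eq, eRank_eq, eRank_eq, add_comm]
    exact add_le_add (M.eRk_mono sdiff_subset) (by simpa using hle)
  · rw [hc]; rfl
  · have := encard_sdiff_add_encard_of_subset hss
    rw [← this, hc] at hE
    by_contra hlt2
    push Not at hlt2
    have h1 : (M.E \ {x, y}).encard ≤ 1 :=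
      Order.le_of_lt_add_one (by simpa [one_add_one_eq_two] using hlt2)
    have h3 : (14 : ℕ∞) ≤ 1 + 2 := hE.trans (by gcongr)
    norm_num at h3

structure Good (M : Matroid α) (φ : α → VV α) : Prop where
  rep : Rep M φ
  pair : ∀ x ∈ M.E, ∀ y ∈ M.E, x ≠ y → M.Indep {x, y}
  fin : M.E.Finite

lemma Good.inj {M : Matroid α} {φ : α → VV α} (h : Good M φ) {x y : α} (hx : x ∈ M.E)
    (hy : y ∈ M.E) (hxy : φ x = φ y) : x = y := by
  by_contra hne
  have h1 := (h.rep {x, y} (by rintro z (rfl | rfl) <;> assumption)).1 (h.pair x hx y hy hne)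
  exact hne (h1.injOn (by simp) (by simp) hxy)

lemma Good.ne_zero {M : Matroid α} {φ : α → VV α} (h : Good M φ) {x y : α} (hx : x ∈ M.E)
    (hy : y ∈ M.E) (hne : x ≠ y) : φ x ≠ 0 := by
  have h1 := (h.rep {x, y} (by rintro z (rfl | rfl) <;> assumption)).1 (h.pair x hx y hy hne)
  exact h1.ne_zero (by simp)

lemma vadd_self (v : VV α) : v + v = 0 := ZModModule.add_self v

lemma sum_eq {u v w : VV α} (h : u + v + w = 0) : w = u + v := by
  have := vadd_self (u + v)
  have h2 : u + v + w = u + v + (u + v) := by rw [h, this]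
  exact add_left_cancel h2

lemma Good.tri_of_sum {M : Matroid α} {φ : α → VV α} (h : Good M φ) {x y z : α} (hx : x ∈ M.E)
    (hy : y ∈ M.E) (hz : z ∈ M.E) (hxy : x ≠ y) (hs : φ x + φ y + φ z = 0) :
    IsTriangle M {x, y, z} ∧ z ≠ x ∧ z ≠ y := by
  have hzx : z ≠ x := by
    rintro rfl
    apply h.ne_zero hy hz hxy.symm
    rw [add_right_comm, vadd_self, zero_add] at hs
    exact hs
  have hzy : z ≠ y := by
    rintro rfl
    apply h.ne_zero hx hz hxy
    rw [add_assoc, vadd_self, add_zero] at hs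
    exact hs
  refine ⟨⟨⟨?_, ?_, ?_⟩, ?_⟩, hzx, hzy⟩
  · rintro w (rfl | rfl | rfl) <;> assumption
  · intro hi
    have e : ({x, y, z} : Set α) = insert z {x, y} := by ext; simp; tauto
    rw [e, h.rep _ (by rintro w (rfl | rfl | rfl) <;> assumption),
      linearIndepOn_insert (by simp [hzx, hzy])] at hi
    apply hi.2
    rw [sum_eq hs]
    exact add_mem (Submodule.subset_span ⟨x, by simp, rfl⟩) (Submodule.subset_span ⟨y, by simp, rfl⟩)
  · intro D hD
    obtain ⟨hD1, hD2⟩ := hD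
    obtain ⟨w, hw, hwD⟩ := Set.not_subset.1 hD2
    have hcase : D ⊆ {y, z} ∨ D ⊆ {x, z} ∨ D ⊆ {x, y} := by
      rcases hw with rfl | rfl | rfl
      · left; intro t ht; have := hD1 ht; rcases this with rfl | h1
        · exact absurd ht hwD
        · exact h1
      · right; left; intro t ht; rcases hD1 ht with rfl | rfl | rfl
        · simp
        · exact absurd ht hwD
        · simp
      · right; right; intro t ht; rcases hD1 ht with rfl | rfl | rfl
        · simp
        · simp
        · exact absurd ht hwD
    rcases hcase with hc | hc | hc
    · exact (h.pair y hy z hz hzy.symm).subset hc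
    · exact (h.pair x hx z hz hzx.symm).subset hc
    · exact (h.pair x hx y hy hxy).subset hc
  · rw [encard_eq_three]
    exact ⟨x, y, z, hxy, hzx.symm, hzy.symm, rfl⟩

lemma Good.sum_of_tri {M : Matroid α} {φ : α → VV α} (h : Good M φ) {T : Set α} {x : α}
    (hT : IsTriangle M T) (hx : x ∈ T) :
    ∃ y z, T = {x, y, z} ∧ x ≠ y ∧ x ≠ z ∧ y ≠ z ∧ x ∈ M.E ∧ y ∈ M.E ∧ z ∈ M.E ∧
      φ x + φ y + φ z = 0 := by
  obtain ⟨⟨hTE, hTd, -⟩, hc⟩ := hT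
  have : ∃ y z, T = {x, y, z} ∧ x ≠ y ∧ x ≠ z ∧ y ≠ z := by
    obtain ⟨a, b, c, hab, hac, hbc, rfl⟩ := encard_eq_three.1 hc
    rcases hx with rfl | rfl | rfl
    · exact ⟨b, c, rfl, hab, hac, hbc⟩
    · exact ⟨a, c, by ext; simp; tauto, hab.symm, hbc, hac⟩
    · exact ⟨a, b, by ext; simp; tauto, hac.symm, hbc.symm, hab⟩
  obtain ⟨y, z, rfl, hxy, hxz, hyz⟩ := this
  have hxE : x ∈ M.E := hTE (by simp)
  have hyE : y ∈ M.E := hTE (by simp)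
  have hzE : z ∈ M.E := hTE (by simp)
  refine ⟨y, z, rfl, hxy, hxz, hyz, hxE, hyE, hzE, ?_⟩
  rw [h.rep _ hTE, linearIndepOn_insert (by simp [hxy, hxz])] at hTd
  have hyz' := (h.rep {y, z} (by rintro w (rfl | rfl) <;> assumption)).1 (h.pair y hyE z hzE hyz)
  have hsp : φ x ∈ Submodule.span (ZMod 2) (φ '' {y, z}) := by
    by_contra hcon
    exact hTd ⟨hyz', hcon⟩
  rw [image_pair, Submodule.mem_span_pair] at hsp
  obtain ⟨a, b, hab⟩ := hsp
  have key : ∀ a : ZMod 2, a = 0 ∨ a = 1 := by decide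
  rcases key a with rfl | rfl <;> rcases key b with rfl | rfl
  · exact absurd (by simpa using hab.symm) (h.ne_zero hxE hyE hxy)
  · exact absurd (h.inj hxE hzE (by simpa using hab.symm)) hxz
  · exact absurd (h.inj hxE hyE (by simpa using hab.symm)) hxy
  · rw [add_assoc, ← hab]; simp [vadd_self]

lemma z2 (a : ZMod 2) : a = 0 ∨ a = 1 := by revert a; decide

lemma Good.deg {M : Matroid α} {φ : α → VV α} (h : Good M φ)
    (h3 : EveryElementInThreeTriangles M) (f : VV α →ₗ[ZMod 2] ZMod 2) {x : α} (hx : x ∈ M.E)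
    (hfx : f (φ x) = 1) :
    {y | y ∈ M.E ∧ f (φ y) = 1 ∧ x ≠ y ∧ ∃ z ∈ M.E, φ x + φ y + φ z = 0}.encard = 3 := by
  set nb := {y | y ∈ M.E ∧ f (φ y) = 1 ∧ x ≠ y ∧ ∃ z ∈ M.E, φ x + φ y + φ z = 0} with hnb
  have hch : ∀ y, ∃ z, y ∈ nb → z ∈ M.E ∧ φ x + φ y + φ z = 0 := by
    intro y
    by_cases hy : y ∈ nb
    · obtain ⟨z, hz⟩ := hy.2.2.2
      exact ⟨z, fun _ => hz⟩
    · exact ⟨y, fun h => absurd h hy⟩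
  choose c hc using hch
  have hfc : ∀ y ∈ nb, f (φ (c y)) = 0 := by
    intro y hy
    rw [sum_eq (hc y hy).2, map_add, hfx, hy.2.1]; rfl
  have hinj : InjOn (fun y => ({x, y, c y} : Set α)) nb := by
    intro y hy y' hy' heq
    have : y' ∈ ({x, y, c y} : Set α) := by
      have h0 : ({x, y, c y} : Set α) = {x, y', c y'} := heq
      rw [h0]; simp
    rcases this with h1 | h1 | h1
    · exact absurd h1.symm hy'.2.2.1
    · exact h1.symm
    · have h2 := hfc y hy
      have h4 : y' = c y := h1
      rw [← h4, hy'.2.1] at h2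
      exact absurd h2 (by decide)
  rw [← h3 x hx, ← hinj.encard_image]
  congr 1
  ext T
  constructor
  · rintro ⟨y, hy, rfl⟩
    exact ⟨(h.tri_of_sum hx hy.1 (hc y hy).1 hy.2.2.1 (hc y hy).2).1, by simp⟩
  · rintro ⟨hT, hxT⟩
    obtain ⟨y, z, rfl, hxy, hxz, hyz, -, hy, hz, hs⟩ := h.sum_of_tri hT hxT
    have hfs : f (φ x) + f (φ y) + f (φ z) = 0 := by rw [← map_add, ← map_add, hs, map_zero]
    rw [hfx] at hfs
    rcases z2 (f (φ y)) with h0 | h1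
    · have h1 : f (φ z) = 1 := by
        rw [h0] at hfs
        rcases z2 (f (φ z)) with h' | h'
        · rw [h'] at hfs; exact absurd hfs (by decide)
        · exact h'
      have hs' : φ x + φ z + φ y = 0 := by rw [add_right_comm]; exact hs
      have hzn : z ∈ nb := ⟨hz, h1, hxz, y, hy, hs'⟩
      have : c z = y := h.inj (hc z hzn).1 hy (by rw [sum_eq (hc z hzn).2, sum_eq hs'])
      refine ⟨z, hzn, ?_⟩
      simp only [this]
      ext; simp; tauto
    · have hyn : y ∈ nb := ⟨hy, h1, hxy, z, hz, hs⟩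
      have : c y = z := h.inj (hc y hyn).1 hz (by rw [sum_eq (hc y hyn).2, sum_eq hs])
      refine ⟨y, hyn, ?_⟩
      simp only [this]

lemma Good.supp_even {M : Matroid α} {φ : α → VV α} (h : Good M φ)
    (h3 : EveryElementInThreeTriangles M) (f : VV α →ₗ[ZMod 2] ZMod 2) {x : α} (hx : x ∈ M.E)
    (hfx : f (φ x) = 1) :
    4 ≤ {y | y ∈ M.E ∧ f (φ y) = 1}.ncard ∧ Even {y | y ∈ M.E ∧ f (φ y) = 1}.ncard := by
  classical
  set S := {y | y ∈ M.E ∧ f (φ y) = 1} with hS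
  have hSf : S.Finite := h.fin.subset fun y hy => hy.1
  have := hSf.fintype
  let G : SimpleGraph S :=
    { Adj := fun a b => a ≠ b ∧ ∃ z ∈ M.E, φ a.1 + φ b.1 + φ z = 0
      symm := ⟨fun a b hab => ⟨hab.1.symm, by
        obtain ⟨z, hz, hs⟩ := hab.2
        exact ⟨z, hz, by rw [add_comm (φ b.1)]; exact hs⟩⟩⟩
      loopless := ⟨fun a ha => ha.1 rfl⟩ }
  have hdeg : ∀ a : S, G.degree a = 3 := by
    intro a
    have h1 := h.deg h3 f a.2.1 a.2.2
    have h2 : (Subtype.val '' (G.neighborSet a)) =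
        {y | y ∈ M.E ∧ f (φ y) = 1 ∧ a.1 ≠ y ∧ ∃ z ∈ M.E, φ a.1 + φ y + φ z = 0} := by
      ext y
      constructor
      · rintro ⟨b, hb, rfl⟩
        exact ⟨b.2.1, b.2.2, fun hh => hb.1 (Subtype.ext hh), hb.2⟩
      · rintro ⟨hy1, hy2, hy3, hy4⟩
        exact ⟨⟨y, hy1, hy2⟩, ⟨fun hh => hy3 (congrArg Subtype.val hh), hy4⟩, rfl⟩
    rw [← h2, Subtype.val_injective.encard_image] at h1
    rw [← G.card_neighborSet_eq_degree]
    rw [← Set.coe_fintypeCard] at h1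
    exact_mod_cast h1
  have hcard : S.ncard = Fintype.card S := by
    rw [← Nat.card_eq_fintype_card]; rfl
  constructor
  · have := G.degree_lt_card_verts ⟨x, hx, hfx⟩
    rw [hdeg] at this
    omega
  · have := G.sum_degrees_eq_twice_card_edges
    simp only [hdeg, Finset.sum_const, Finset.card_univ, smul_eq_mul] at this
    rw [hcard, Nat.even_iff]
    omega

lemma Good.supp_six {M : Matroid α} {φ : α → VV α} (h : Good M φ)
    (h3 : EveryElementInThreeTriangles M) (hno4 : ¬ ∃ C, Cocircuit M C ∧ C.encard = 4)
    (f : VV α →ₗ[ZMod 2] ZMod 2) {x : α} (hx : x ∈ M.E)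
    (hfx : f (φ x) = 1) :
    6 ≤ {y | y ∈ M.E ∧ f (φ y) = 1}.ncard := by
  obtain ⟨h4, hev⟩ := h.supp_even h3 f hx hfx
  by_contra hlt
  have heq : {y | y ∈ M.E ∧ f (φ y) = 1}.ncard = 4 := by
    obtain ⟨k, hk⟩ := hev
    omega
  set S := {y | y ∈ M.E ∧ f (φ y) = 1} with hS
  have hSE : S ⊆ M.E := fun y hy => hy.1
  have hSf : S.Finite := h.fin.subset hSE
  refine hno4 ⟨S, ⟨hSE, ?_, ?_⟩, ?_⟩
  · intro hi
    have hsp : M.Spanning (M.E \ S) := (coindep_iff_compl_spanning hSE).1 hi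
    have hxc : x ∈ M.closure (M.E \ S) := by rw [hsp.closure_eq]; exact hx
    rw [h.rep.mem_span sdiff_subset hx] at hxc
    have : Submodule.span (ZMod 2) (φ '' (M.E \ S)) ≤ LinearMap.ker f := by
      rw [Submodule.span_le]
      rintro _ ⟨y, hy, rfl⟩
      rcases z2 (f (φ y)) with h0 | h0
      · exact h0
      · exact absurd ⟨hy.1, h0⟩ hy.2
    have h0 : f (φ x) = 0 := this hxc
    rw [hfx] at h0
    exact absurd h0 (by decide)
  · intro D hD
    have hDE : D ⊆ M.E := hD.1.trans hSE
    by_contra hni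
    have hns : ¬ M.Spanning (M.E \ D) := fun hsp => hni ((coindep_iff_compl_spanning hDE).2 hsp)
    rw [spanning_iff_ground_subset_closure sdiff_subset, Set.not_subset] at hns
    obtain ⟨z, hz, hzc⟩ := hns
    obtain ⟨g, hg1, hg2⟩ := h.rep.functional sdiff_subset hz hzc
    have h5 := (h.supp_even h3 g hz hg1).1
    have hsub : {y | y ∈ M.E ∧ g (φ y) = 1} ⊆ D := by
      rintro y ⟨hyE, hy1⟩
      by_contra hyD
      rw [hg2 y ⟨hyE, hyD⟩] at hy1
      exact absurd hy1 (by decide)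
    have h6 := Set.ncard_le_ncard hsub (hSf.subset hD.1)
    have h7 := Set.ncard_lt_ncard hD hSf
    omega
  · rw [← hSf.cast_ncard_eq, heq]; rfl

noncomputable def rk (M : Matroid α) (X : Set α) : ℕ := (M.eRk X).toNat

lemma rk_cast {M : Matroid α} (hf : M.E.Finite) (X : Set α) : ((rk M X : ℕ) : ℕ∞) = M.eRk X := by
  apply ENat.natCast_toNat
  have h1 : M.eRk X ≤ M.E.encard := (M.eRk_le_eRank X).trans M.eRank_le_encard_ground
  exact (h1.trans_lt (by simpa using hf)).ne

lemma rk_mono {M : Matroid α} (hf : M.E.Finite) {X Y : Set α} (h : X ⊆ Y) : rk M X ≤ rk M Y := by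
  have := M.eRk_mono h
  rw [← rk_cast hf, ← rk_cast hf] at this
  exact_mod_cast this

lemma rk_insert_le {M : Matroid α} (hf : M.E.Finite) (x : α) (X : Set α) :
    rk M (insert x X) ≤ rk M X + 1 := by
  have := M.eRk_insert_le_add_one x X
  rw [← rk_cast hf, ← rk_cast hf] at this
  exact_mod_cast this

lemma rk_insert_mem {M : Matroid α} {x : α} {X : Set α} (h : x ∈ M.closure X) :
    rk M (insert x X) = rk M X := by
  unfold rk
  rw [← M.eRk_closure_eq (insert x X), closure_insert_eq_of_mem_closure h, M.eRk_closure_eq]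

lemma rk_insert_notMem {M : Matroid α} (hf : M.E.Finite) {x : α} {X : Set α} (hx : x ∈ M.E)
    (h : x ∉ M.closure X) : rk M (insert x X) = rk M X + 1 := by
  have := M.eRk_insert_eq_add_one (e := x) (X := X) ⟨hx, h⟩
  rw [← rk_cast hf, ← rk_cast hf] at this
  exact_mod_cast this

lemma Good.cofun {M : Matroid α} {φ : α → VV α} (h : Good M φ) {Z : Set α}
    (hr : rk M (M.E \ Z) < rk M M.E) :
    ∃ f : VV α →ₗ[ZMod 2] ZMod 2, ∃ z ∈ M.E, f (φ z) = 1 ∧ ∀ x ∈ M.E \ Z, f (φ x) = 0 := by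
  have hns : ¬ M.E ⊆ M.closure (M.E \ Z) := by
    intro hs
    have h1 := rk_mono h.fin hs
    have h2 : rk M (M.closure (M.E \ Z)) = rk M (M.E \ Z) := by
      unfold rk; rw [M.eRk_closure_eq]
    omega
  obtain ⟨z, hz, hzc⟩ := Set.not_subset.1 hns
  obtain ⟨f, hf⟩ := h.rep.functional sdiff_subset hz hzc
  exact ⟨f, z, hz, hf⟩

lemma Good.cosp {M : Matroid α} {φ : α → VV α} (h : Good M φ)
    (h3 : EveryElementInThreeTriangles M) (hno4 : ¬ ∃ C, Cocircuit M C ∧ C.encard = 4)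
    {Z : Set α} (hZE : Z ⊆ M.E) (hZ : Z.ncard ≤ 5) : rk M (M.E \ Z) = rk M M.E := by
  by_contra hne
  have hlt : rk M (M.E \ Z) < rk M M.E := lt_of_le_of_ne (rk_mono h.fin sdiff_subset) hne
  obtain ⟨f, z, hz, hfz, hf⟩ := h.cofun hlt
  have h6 := h.supp_six h3 hno4 f hz hfz
  have hsub : {y | y ∈ M.E ∧ f (φ y) = 1} ⊆ Z := by
    rintro y ⟨hyE, hy1⟩
    by_contra hyD
    rw [hf y ⟨hyE, hyD⟩] at hy1
    exact absurd hy1 (by decide)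
  have := Set.ncard_le_ncard hsub (h.fin.subset hZE)
  omega

/-- A set of rank at most 3 on which a functional is 1 has at most 4 elements. -/
lemma Good.affine {M : Matroid α} {φ : α → VV α} (h : Good M φ) {X D : Set α} (hX : X ⊆ M.E)
    (hr : rk M X ≤ 3) (f : VV α →ₗ[ZMod 2] ZMod 2) (hD : D ⊆ X) (hf : ∀ x ∈ D, f (φ x) = 1) :
    D.ncard ≤ 4 := by
  by_contra hlt
  have hDfin : D.Finite := h.fin.subset (hD.trans hX)
  have hne : D.Nonempty := by
    rw [← Set.ncard_pos hDfin]; omega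
  obtain ⟨d, hd⟩ := hne
  have hW := h.rep.span_card (n := 3) hX (by rw [← rk_cast h.fin]; exact_mod_cast hr)
  set W := Submodule.span (ZMod 2) (φ '' X)
  have hin : ∀ x ∈ D, φ x ∈ W := fun x hx => Submodule.subset_span ⟨x, hD hx, rfl⟩
  have hWfin : (W : Set (VV α)).Finite := finite_of_encard_le_coe hW
  have hWc : (W : Set (VV α)).ncard ≤ 8 := by
    rw [← hWfin.cast_ncard_eq] at hW
    exact_mod_cast hW
  have hi1 : InjOn φ D := fun x hx y hy hxy => h.inj (hX (hD hx)) (hX (hD hy)) hxy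
  have hi2 : InjOn (fun x => φ d + φ x) D := fun x hx y hy hxy => hi1 hx hy (add_left_cancel hxy)
  have hdisj : Disjoint (φ '' D) ((fun x => φ d + φ x) '' D) := by
    rw [Set.disjoint_left]
    rintro _ ⟨x, hx, rfl⟩ ⟨y, hy, hxy⟩
    have h1 := congrArg f hxy
    simp only [map_add, hf d hd, hf x hx, hf y hy] at h1
    exact absurd h1 (by decide)
  have hun : φ '' D ∪ (fun x => φ d + φ x) '' D ⊆ (W : Set (VV α)) := by
    rintro v (⟨x, hx, rfl⟩ | ⟨x, hx, rfl⟩)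
    · exact hin x hx
    · exact add_mem (hin d hd) (hin x hx)
  have h1 := Set.ncard_le_ncard hun hWfin
  rw [Set.ncard_union_eq hdisj (hDfin.image _) (hDfin.image _), hi1.ncard_image,
    hi2.ncard_image] at h1
  omega

lemma dual_closure {M : Matroid α} {Z : Set α} {z : α} (hz : z ∈ Z)
    (h : z ∈ M✶.closure (M.E \ Z)) : z ∉ M.closure (Z \ {z}) := by
  intro h2
  obtain ⟨C, hC, hC1, hzC⟩ := (mem_closure_iff_exists_isCircuit (by simp [hz])).1 h
  obtain ⟨D, hD, hD1, hzD⟩ := (mem_closure_iff_exists_isCircuit (by simp)).1 h2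
  refine hD1.inter_isCocircuit_ne_singleton (K := C) (e := z) hC1 ?_
  ext t
  constructor
  · rintro ⟨htD, htC⟩
    rcases hD htD with rfl | h3
    · rfl
    · rcases hC htC with rfl | h4
      · rfl
      · exact absurd h3.1 h4.2
  · rintro rfl
    exact ⟨hzD, hzC⟩

lemma Good.key {M : Matroid α} {φ : α → VV α} (h : Good M φ)
    (h3 : EveryElementInThreeTriangles M) (hno4 : ¬ ∃ C, Cocircuit M C ∧ C.encard = 4) :
    ∀ n : ℕ, ∀ Z : Set α, Z.ncard = n → Z ⊆ M.E → rk M Z + rk M (M.E \ Z) ≤ rk M M.E + 3 →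
      fcl M (M.E \ Z) = M.E → rk M Z ≤ 3 := by
  intro n
  induction n with
  | zero =>
    intro Z hn hZ _ _
    have : Z = ∅ := (Set.ncard_eq_zero (h.fin.subset hZ)).1 hn
    subst this
    simp [rk]
  | succ n ih =>
    intro Z hn hZ hl hfcl
    have hZfin := h.fin.subset hZ
    by_cases h5 : Z.ncard ≤ 5
    · have := h.cosp h3 hno4 hZ h5
      omega
    have hex : ∃ z ∈ Z, z ∈ M.closure (M.E \ Z) ∨ z ∈ M✶.closure (M.E \ Z) := by
      by_contra hcon
      push Not at hcon
      have hfc : FullyClosed M (M.E \ Z) := by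
        constructor
        · apply subset_antisymm
          · intro t ht
            exact ⟨M.closure_subset_ground _ ht, fun htZ => (hcon t htZ).1 ht⟩
          · exact M.subset_closure _ sdiff_subset
        · apply subset_antisymm
          · intro t ht
            exact ⟨M✶.closure_subset_ground _ ht, fun htZ => (hcon t htZ).2 ht⟩
          · exact M✶.subset_closure _ sdiff_subset
      have h1 : fcl M (M.E \ Z) ⊆ M.E \ Z := sInter_subset_of_mem ⟨subset_rfl, hfc⟩
      rw [hfcl] at h1
      have hne : Z.Nonempty := by rw [← Set.ncard_pos hZfin]; omega
      obtain ⟨t, ht⟩ := hne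
      exact (h1 (hZ ht)).2 ht
    obtain ⟨z, hz, hzc⟩ := hex
    have hcompl : M.E \ (Z \ {z}) = insert z (M.E \ Z) := by
      ext t
      simp only [mem_sdiff, mem_singleton_iff, mem_insert_iff, not_and, not_not]
      constructor
      · rintro ⟨h1, h2⟩
        by_cases ht : t ∈ Z
        · exact Or.inl (h2 ht)
        · exact Or.inr ⟨h1, ht⟩
      · rintro (rfl | ⟨h1, h2⟩)
        · exact ⟨hZ hz, fun _ => rfl⟩
        · exact ⟨h1, fun h => absurd h h2⟩
    have hins : insert z (Z \ {z}) = Z := by simp [hz]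
    have hr : rk M (Z \ {z}) ≤ 3 := by
      apply ih
      · rw [Set.ncard_sdiff_singleton_of_mem hz, hn]; rfl
      · exact sdiff_subset.trans hZ
      · rw [hcompl]
        rcases hzc with hzc | hzc
        · have h1 := rk_insert_mem hzc
          have h2 := rk_mono (M := M) h.fin (sdiff_subset : Z \ {z} ⊆ Z)
          omega
        · have h1 := rk_insert_le h.fin z (M.E \ Z)
          have h2 := rk_insert_notMem h.fin (hZ hz) (dual_closure hz hzc)
          rw [hins] at h2
          omega
      · rw [hcompl]
        apply subset_antisymm
        · apply sInter_subset_of_mem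
          refine ⟨insert_subset (hZ hz) sdiff_subset, ?_, ?_⟩
          · exact M.closure_ground
          · exact M✶.closure_ground
        · conv_lhs => rw [← hfcl]
          unfold fcl
          apply sInter_subset_sInter
          rintro F ⟨hF1, hF2⟩
          exact ⟨(subset_insert _ _).trans hF1, hF2⟩
    by_contra hgt
    have hlt : rk M (M.E \ Z) < rk M M.E := by omega
    obtain ⟨f, w, hw, hfw, hf⟩ := h.cofun hlt
    have h6 := h.supp_six h3 hno4 f hw hfw
    set S := {y | y ∈ M.E ∧ f (φ y) = 1} with hS
    have hSfin : S.Finite := h.fin.subset fun y hy => hy.1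
    have hsub : S ⊆ Z := by
      rintro y ⟨hyE, hy1⟩
      by_contra hyD
      rw [hf y ⟨hyE, hyD⟩] at hy1
      exact absurd hy1 (by decide)
    have h4 := h.affine (X := Z \ {z}) (D := S \ {z}) (sdiff_subset.trans hZ) hr f
      (sdiff_subset_sdiff_left hsub) (fun x hx => hx.1.2)
    have h7 := Set.ncard_le_ncard_sdiff_add_ncard S {z} (Set.finite_singleton z)
    rw [Set.ncard_singleton] at h7
    omega

structure Tr (M : Matroid α) (e : α) (S : Set α) : Prop where
  sub : S ⊆ M.E \ {e}
  ex : ∀ f ∈ M.E \ {e}, ∃ s ∈ S, f ∈ M.closure {s, e}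
  uniq : ∀ f ∈ M.E \ {e}, ∀ s ∈ S, ∀ t ∈ S, f ∈ M.closure {s, e} → f ∈ M.closure {t, e} → s = t

lemma Good.notMem_cl {M : Matroid α} {φ : α → VV α} (h : Good M φ) {e f : α} (he : e ∈ M.E)
    (hf : f ∈ M.E \ {e}) : f ∉ M.closure {e} := by
  have hi := h.pair f hf.1 e he hf.2
  have := hi.notMem_closure_sdiff_of_mem (e := f) (by simp)
  have hd : ({f, e} : Set α) \ {f} = {e} := by
    have : f ∉ ({e} : Set α) := hf.2
    simp [this]
  rwa [hd] at this

lemma Good.cl_congr {M : Matroid α} {φ : α → VV α} (h : Good M φ) {e a b : α} (he : e ∈ M.E)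
    (hb : b ∈ M.E \ {e}) (hab : b ∈ M.closure {a, e}) :
    M.closure {b, e} = M.closure {a, e} :=
  closure_insert_congr (X := {e}) ⟨hab, h.notMem_cl he hb⟩

lemma Good.con_cl {M : Matroid α} {φ : α → VV α} (h : Good M φ) {e a b : α} (he : e ∈ M.E)
    (ha : a ∈ M.E \ {e}) (hb : b ∈ M.E \ {e}) :
    (M ／ {e}).closure {a} = (M ／ {e}).closure {b} ↔ b ∈ M.closure {a, e} := by
  rw [contract_closure_eq, contract_closure_eq, singleton_union, singleton_union]
  constructor
  · intro heq
    have : b ∈ M.closure {b, e} \ {e} :=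
      ⟨M.subset_closure {b, e} (by rintro t (rfl | rfl) <;> simp_all) (by simp), hb.2⟩
    rw [← heq] at this
    exact this.1
  · intro hab
    rw [h.cl_congr he hb hab]

lemma Good.con_indep {M : Matroid α} {φ : α → VV α} (h : Good M φ) {e a : α} (he : e ∈ M.E)
    (ha : a ∈ M.E \ {e}) {I : Set α} : (M ／ {e}).Indep I ↔ e ∉ I ∧ M.Indep (insert e I) := by
  have hi : M.Indep {e} := (h.pair a ha.1 e he ha.2).subset (by simp)
  exact (indep_singleton.1 hi).contractElem_indep_iff

lemma Good.tr {M : Matroid α} {φ : α → VV α} (h : Good M φ) {e : α} (he : e ∈ M.E) {S : Set α}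
    (hS : S ⊆ (contract M {e}).E)
    (hu : ∀ f, Nonloop (contract M {e}) f →
      ∃! s, s ∈ S ∧ (contract M {e}).closure {s} = (contract M {e}).closure {f}) : Tr M e S := by
  simp only [contract_eq] at hS hu
  rw [contract_ground] at hS
  have hnl : ∀ f ∈ M.E \ {e}, Nonloop (M ／ {e}) f := by
    intro f hf
    unfold Nonloop
    rw [h.con_indep he hf]
    exact ⟨fun hh => hf.2 hh.symm, h.pair e he f hf.1 (fun hh => hf.2 hh.symm)⟩
  refine ⟨hS, ?_, ?_⟩
  · intro f hf
    obtain ⟨s, ⟨hs, hs2⟩, -⟩ := hu f (hnl f hf)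
    exact ⟨s, hs, (h.con_cl he (hS hs) hf).1 hs2⟩
  · intro f hf s hs t ht hfs hft
    exact (hu f (hnl f hf)).unique ⟨hs, (h.con_cl he (hS hs) hf).2 hfs⟩
      ⟨ht, (h.con_cl he (hS ht) hf).2 hft⟩

lemma Good.indep3 {M : Matroid α} {φ : α → VV α} (h : Good M φ) {e : α} (he : e ∈ M.E) {S : Set α}
    (t : Tr M e S) {x y : α} (hx : x ∈ S) (hy : y ∈ S) (hxy : x ≠ y) : M.Indep {e, x, y} := by
  by_contra hd
  have hx' := t.sub hx
  have hy' := t.sub hy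
  apply hxy
  have hyE : y ∈ M.closure {y, e} :=
    M.subset_closure {y, e} (by rintro t (rfl | rfl) <;> simp_all) (by simp)
  refine t.uniq y hy' x hx y hy ?_ hyE
  have hi := h.pair x hx'.1 e he hx'.2
  rw [hi.mem_closure_iff']
  refine ⟨hy'.1, fun hi2 => absurd ?_ hd⟩
  convert hi2 using 1
  ext; simp; tauto

lemma Good.con_rk {M : Matroid α} {φ : α → VV α} (h : Good M φ) {e a : α} (he : e ∈ M.E)
    (ha : a ∈ M.E \ {e}) {S X : Set α} (hXS : X ⊆ S) (hS : S ⊆ M.E \ {e}) :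
    eRank (contract M {e} ↾ S) X + 1 = rk M (insert e X) := by
  rw [eRank_eq, contract_eq, restrict_eRk_eq _ hXS, rk_cast h.fin]
  have hi : M.Indep {e} := (h.pair a ha.1 e he ha.2).subset (by simp)
  have hX : X ⊆ M.E \ {e} := hXS.trans hS
  obtain ⟨J, hJ⟩ := (M ／ {e}).exists_isBasis X hX
  have h1 := hi.union_isBasis_union_of_contract_isBasis hJ
  have heJ : e ∉ J := fun hh => (hX (hJ.subset hh)).2 rfl
  rw [← union_singleton, h1.eRk_eq_encard, hJ.eRk_eq_encard, union_singleton,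
    encard_insert_of_notMem heJ]

lemma Good.sepM {M : Matroid α} {φ : α → VV α} (h : Good M φ)
    (h3 : EveryElementInThreeTriangles M) (hno4 : ¬ ∃ C, Cocircuit M C ∧ C.encard = 4)
    (hI4 : InternallyFourConnected M)
    (hseq : ∀ X Y, IsExact4Separation M X Y → fcl M X = M.E ∨ fcl M Y = M.E)
    {e : α} (he : e ∈ M.E) {P Q : Set α} (hdj : Disjoint P Q) (hPQ : P ∪ Q = M.E \ {e})
    {k : ℕ} (hk1 : 1 ≤ k) (hk : k ≤ 3) (_heP : e ∈ M.closure P)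
    (hr : rk M (insert e P) + rk M (insert e Q) ≤ rk M M.E + k) :
    rk M (insert e P) ≤ k ∨ rk M (insert e Q) ≤ k := by
  have hP : P ⊆ M.E \ {e} := hPQ ▸ subset_union_left
  have hQ : Q ⊆ M.E \ {e} := hPQ ▸ subset_union_right
  have hAE : insert e P ⊆ M.E := insert_subset he (hP.trans sdiff_subset)
  have hQE : Q ⊆ M.E := hQ.trans sdiff_subset
  have heQ : e ∉ Q := fun hh => (hQ hh).2 rfl
  have hdj' : Disjoint (insert e P) Q := by
    rw [disjoint_insert_left]; exact ⟨heQ, hdj⟩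
  have hun : insert e P ∪ Q = M.E := by
    rw [insert_union, hPQ]; simp [he]
  have hEQ : M.E \ Q = insert e P := by
    rw [← hun, union_sdiff_right]; exact hdj'.sdiff_eq_left
  have hEA : M.E \ insert e P = Q := by
    rw [← hun, union_sdiff_left]; exact hdj'.sdiff_eq_right
  have hmQ : rk M Q ≤ rk M (insert e Q) := rk_mono h.fin (subset_insert _ _)
  by_cases hQ5 : Q.ncard ≤ 5
  · have := h.cosp h3 hno4 hQE hQ5
    rw [hEQ] at this
    right; omega
  by_cases hA5 : (insert e P).ncard ≤ 5
  · have := h.cosp h3 hno4 hAE hA5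
    rw [hEA] at this
    left; omega
  have hAc : ((insert e P).ncard : ℕ∞) = (insert e P).encard := (h.fin.subset hAE).cast_ncard_eq
  have hQc : (Q.ncard : ℕ∞) = Q.encard := (h.fin.subset hQE).cast_ncard_eq
  have hsep : ∀ j : ℕ, 1 ≤ j → j ≤ 3 → rk M (insert e P) + rk M Q ≤ rk M M.E + (j - 1) →
      IsKSeparation M j (insert e P) Q := by
    intro j hj1 hj3 hle
    refine ⟨hdj', hun, ?_, ?_, ?_⟩
    · rw [eRk_eq, eRank_eq, eRank_eq, ← rk_cast h.fin, ← rk_cast h.fin, ← rk_cast h.fin]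
      exact_mod_cast hle
    · rw [← hAc]; exact_mod_cast (by omega)
    · rw [← hQc]; exact_mod_cast (by omega)
  by_cases hk2 : rk M (insert e P) + rk M Q ≤ rk M M.E + 2
  · exfalso
    have hA3 : (insert e P).encard ≠ 3 := by
      rw [← hAc]; exact_mod_cast (by omega)
    have hQ3 : Q.encard ≠ 3 := by
      rw [← hQc]; exact_mod_cast (by omega)
    rcases hI4.2 _ _ (hsep 3 (by omega) le_rfl hk2) with h1 | h1 | h1 | h1
    · exact hA3 h1.2
    · exact hA3 h1.2
    · exact hQ3 h1.2
    · exact hQ3 h1.2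
  have hk3 : k = 3 := by omega
  subst hk3
  have heq : rk M (insert e P) + rk M Q = rk M M.E + 3 := by omega
  have hex : IsExact4Separation M (insert e P) Q := by
    refine ⟨hdj', hun, ?_, ?_, ?_⟩
    · rw [eRk_eq, eRank_eq, eRank_eq, ← rk_cast h.fin, ← rk_cast h.fin, ← rk_cast h.fin]
      exact_mod_cast heq
    · rw [← hAc]; exact_mod_cast (by omega)
    · rw [← hQc]; exact_mod_cast (by omega)
  rcases hseq _ _ hex with hf | hf
  · right
    have := h.key h3 hno4 _ Q rfl hQE (by rw [hEQ]; omega) (by rw [hEQ]; exact hf)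
    omega
  · left
    exact h.key h3 hno4 _ (insert e P) rfl hAE (by rw [hEA]; omega) (by rw [hEA]; exact hf)

lemma cl_rk {M : Matroid α} (hf : M.E.Finite) {X Y : Set α} (h1 : X ⊆ Y) (h2 : Y ⊆ M.closure X) :
    rk M Y = rk M X := by
  apply le_antisymm _ (rk_mono hf h1)
  have := rk_mono hf h2
  have h3 : rk M (M.closure X) = rk M X := by unfold rk; rw [M.eRk_closure_eq]
  omega

lemma Good.sepN {M : Matroid α} {φ : α → VV α} (h : Good M φ)
    (h3 : EveryElementInThreeTriangles M) (hno4 : ¬ ∃ C, Cocircuit M C ∧ C.encard = 4)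
    (hI4 : InternallyFourConnected M)
    (hseq : ∀ X Y, IsExact4Separation M X Y → fcl M X = M.E ∨ fcl M Y = M.E)
    {e : α} (he : e ∈ M.E) {S : Set α} (t : Tr M e S) {X Y : Set α} (hdj : Disjoint X Y)
    (hXY : X ∪ Y = S)
    {k : ℕ} (hk1 : 1 ≤ k) (hk : k ≤ 3)
    (hr : rk M (insert e X) + rk M (insert e Y) ≤ rk M M.E + k) :
    rk M (insert e X) ≤ k ∨ rk M (insert e Y) ≤ k := by
  have hXS : X ⊆ S := hXY ▸ subset_union_left
  have hYS : Y ⊆ S := hXY ▸ subset_union_right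
  let cls : Set α → Set α := fun Z => {f | f ∈ M.E \ {e} ∧ ∃ s ∈ Z, f ∈ M.closure {s, e}}
  have hclsE : ∀ Z, cls Z ⊆ M.E \ {e} := fun Z f hf => hf.1
  have hsub : ∀ Z ⊆ S, Z ⊆ cls Z := by
    intro Z hZ s hs
    have hsE := t.sub (hZ hs)
    exact ⟨hsE, s, hs, M.subset_closure {s, e} (by rintro t (rfl | rfl) <;> simp_all) (by simp)⟩
  have hrk : ∀ Z ⊆ S, rk M (insert e (cls Z)) = rk M (insert e Z) := by
    intro Z hZ
    have hZE : insert e Z ⊆ M.E := insert_subset he ((hZ.trans t.sub).trans sdiff_subset)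
    refine cl_rk h.fin (insert_subset_insert (hsub Z hZ)) ?_
    apply insert_subset
    · exact M.subset_closure _ hZE (by simp)
    · rintro f ⟨hf, s, hs, hfs⟩
      refine M.closure_subset_closure ?_ hfs
      rintro w (rfl | rfl)
      · exact Or.inr hs
      · exact Or.inl rfl
  have hdj2 : Disjoint (cls X) (cls Y) := by
    rw [Set.disjoint_left]
    rintro f ⟨hf, s, hs, hfs⟩ ⟨-, s', hs', hfs'⟩
    have := t.uniq f hf s (hXS hs) s' (hYS hs') hfs hfs'
    subst this
    exact Set.disjoint_left.1 hdj hs hs'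
  have hun : cls X ∪ cls Y = M.E \ {e} := by
    apply subset_antisymm (union_subset (hclsE X) (hclsE Y))
    intro f hf
    obtain ⟨s, hs, hfs⟩ := t.ex f hf
    rw [← hXY] at hs
    rcases hs with hs | hs
    · exact Or.inl ⟨hf, s, hs, hfs⟩
    · exact Or.inr ⟨hf, s, hs, hfs⟩
  obtain ⟨T, hT, heT⟩ : ∃ T, IsTriangle M T ∧ e ∈ T := by
    have hne : {T : Set α | IsTriangle M T ∧ e ∈ T}.Nonempty := by
      rw [← encard_pos, h3 e he]; norm_num
    exact hne
  obtain ⟨a, b, -, hea, heb, hab, -, ha, hb, hs⟩ := h.sum_of_tri hT heT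
  have ha' : a ∈ M.E \ {e} := ⟨ha, fun hh => hea hh.symm⟩
  have hb' : b ∈ M.E \ {e} := ⟨hb, fun hh => heb hh.symm⟩
  have hbcl : b ∈ M.closure {a, e} := by
    rw [h.rep.mem_span (by rintro w (rfl | rfl) <;> assumption) hb, sum_eq hs]
    exact add_mem (Submodule.subset_span ⟨e, by simp, rfl⟩) (Submodule.subset_span ⟨a, by simp, rfl⟩)
  have hecl : ∀ Z, a ∈ cls Z → e ∈ M.closure (cls Z) := by
    rintro Z ⟨-, s, hs', has⟩
    have hbs : b ∈ M.closure {s, e} := by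
      rw [h.cl_congr he ha' has] at hbcl; exact hbcl
    have hac : a ∈ cls Z := ⟨ha', s, hs', has⟩
    have hbc : b ∈ cls Z := ⟨hb', s, hs', hbs⟩
    rw [h.rep.mem_span ((hclsE Z).trans sdiff_subset) he]
    have : φ e = φ a + φ b := sum_eq (by rw [← hs]; abel)
    rw [this]
    exact add_mem (Submodule.subset_span ⟨a, hac, rfl⟩) (Submodule.subset_span ⟨b, hbc, rfl⟩)
  rw [← hrk X hXS, ← hrk Y hYS] at hr ⊢
  have hau : a ∈ cls X ∪ cls Y := by rw [hun]; exact ha'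
  rcases hau with h1 | h1
  · exact h.sepM h3 hno4 hI4 hseq he hdj2 hun hk1 hk (hecl _ h1) hr
  · exact (h.sepM h3 hno4 hI4 hseq he hdj2.symm (by rw [union_comm]; exact hun) hk1 hk
      (hecl _ h1) (by omega)).symm

lemma Good.card3 {M : Matroid α} {φ : α → VV α} (h : Good M φ)
    {e : α} (he : e ∈ M.E) {S : Set α} (t : Tr M e S) {X : Set α} (hX : X ⊆ S)
    (hr : rk M (insert e X) ≤ 3) : X.ncard ≤ 3 := by
  by_contra hlt
  have hXE : insert e X ⊆ M.E := insert_subset he ((hX.trans t.sub).trans sdiff_subset)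
  have hXfin : X.Finite := (h.fin.subset hXE).subset (subset_insert _ _)
  have hW := h.rep.span_card (n := 3) hXE (by rw [← rk_cast h.fin]; exact_mod_cast hr)
  set W := Submodule.span (ZMod 2) (φ '' (insert e X))
  have hin : ∀ x ∈ X, φ x ∈ W := fun x hx => Submodule.subset_span ⟨x, Or.inr hx, rfl⟩
  have hine : φ e ∈ W := Submodule.subset_span ⟨e, Or.inl rfl, rfl⟩
  have hWfin : (W : Set (VV α)).Finite := finite_of_encard_le_coe hW
  have hWc : (W : Set (VV α)).ncard ≤ 8 := by
    rw [← hWfin.cast_ncard_eq] at hW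
    exact_mod_cast hW
  have hXe : ∀ x ∈ X, x ∈ M.E \ {e} := fun x hx => t.sub (hX hx)
  have hi1 : InjOn φ X := fun x hx y hy hxy => h.inj (hXe x hx).1 (hXe y hy).1 hxy
  have hi2 : InjOn (fun x => φ e + φ x) X := fun x hx y hy hxy => hi1 hx hy (add_left_cancel hxy)
  have hdisj : Disjoint (φ '' X) ((fun x => φ e + φ x) '' X) := by
    rw [Set.disjoint_left]
    rintro _ ⟨x, hx, rfl⟩ ⟨y, hy, hxy⟩
    have hxy' : φ e + φ y = φ x := hxy
    by_cases hne : x = y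
    · subst hne
      have h0 : φ e = 0 := by simpa using hxy'
      exact h.ne_zero he (hXe x hx).1 (fun hh => (hXe x hx).2 hh.symm) h0
    · have hi := h.indep3 he t (hX hx) (hX hy) hne
      have hsum : φ e + φ y + φ x = 0 := by rw [hxy', vadd_self]
      have htri := (h.tri_of_sum he (hXe y hy).1 (hXe x hx).1
        (fun hh => (hXe y hy).2 hh.symm) hsum).1
      refine htri.1.2.1 ?_
      convert hi using 1
      ext; simp; tauto
  have hun : φ '' X ∪ (fun x => φ e + φ x) '' X ⊆ (W : Set (VV α)) \ {0} := by
    rintro v (⟨x, hx, rfl⟩ | ⟨x, hx, rfl⟩)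
    · exact ⟨hin x hx, h.ne_zero (hXe x hx).1 he (hXe x hx).2⟩
    · refine ⟨add_mem hine (hin x hx), fun h0 => ?_⟩
      have h0' : φ e + φ x = 0 := h0
      have : φ e = φ x := by
        have h1 : φ e + φ x = φ x + φ x := by rw [h0', vadd_self]
        exact add_right_cancel h1
      exact (hXe x hx).2 (h.inj he (hXe x hx).1 this).symm
  have h1 := Set.ncard_le_ncard hun (hWfin.subset sdiff_subset)
  rw [Set.ncard_union_eq hdisj (hXfin.image _) (hXfin.image _), hi1.ncard_image,
    hi2.ncard_image, Set.ncard_sdiff_singleton_of_mem (zero_mem W)] at h1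
  omega

lemma Good.cardS {M : Matroid α} {φ : α → VV α} (h : Good M φ) (hE : (14 : ℕ∞) ≤ M.E.encard)
    {e : α} (he : e ∈ M.E) {S : Set α} (t : Tr M e S) : 7 ≤ S.ncard := by
  have hSfin : S.Finite := h.fin.subset (t.sub.trans sdiff_subset)
  have hsub : φ '' (M.E \ {e}) ⊆ φ '' S ∪ (fun x => φ e + φ x) '' S := by
    rintro _ ⟨f, hf, rfl⟩
    obtain ⟨s, hs, hfs⟩ := t.ex f hf
    have hsE := t.sub hs
    rw [h.rep.mem_span (by rintro w (rfl | rfl) <;> simp_all) hf.1, image_pair,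
      Submodule.mem_span_pair] at hfs
    obtain ⟨a, b, hab⟩ := hfs
    rcases z2 a with rfl | rfl <;> rcases z2 b with rfl | rfl
    · exact absurd (by simpa using hab.symm) (h.ne_zero hf.1 he hf.2)
    · exact absurd (h.inj hf.1 he (by simpa using hab.symm)) hf.2
    · exact Or.inl ⟨s, hs, by simpa using hab⟩
    · exact Or.inr ⟨s, hs, by simpa [add_comm] using hab⟩
  have h1 := Set.ncard_le_ncard hsub ((hSfin.image _).union (hSfin.image _))
  have h2 := Set.ncard_union_le (φ '' S) ((fun x => φ e + φ x) '' S)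
  have h4 := Set.ncard_image_le (f := φ) hSfin
  have h5 := Set.ncard_image_le (f := fun x => φ e + φ x) hSfin
  have hi : InjOn φ (M.E \ {e}) := fun x hx y hy hxy => h.inj hx.1 hy.1 hxy
  rw [hi.ncard_image, Set.ncard_sdiff_singleton_of_mem he] at h1
  have h6 : 14 ≤ M.E.ncard := by
    rw [← h.fin.cast_ncard_eq] at hE
    exact_mod_cast hE
  omega

lemma Good.triN {M : Matroid α} {φ : α → VV α} (h : Good M φ)
    {e : α} (he : e ∈ M.E) {S : Set α} (t : Tr M e S) {X : Set α} (hX : X ⊆ S)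
    (hr : rk M (insert e X) ≤ 3) (hc : (3 : ℕ∞) ≤ X.encard) :
    IsTriangle (contract M {e} ↾ S) X := by
  have hXE : insert e X ⊆ M.E := insert_subset he ((hX.trans t.sub).trans sdiff_subset)
  have hXfin : X.Finite := (h.fin.subset hXE).subset (subset_insert _ _)
  have hcard := h.card3 he t hX hr
  have hc3 : X.ncard = 3 := by
    rw [← hXfin.cast_ncard_eq] at hc
    have : 3 ≤ X.ncard := by exact_mod_cast hc
    omega
  have heX : e ∉ X := fun hh => (t.sub (hX hh)).2 rfl
  have hne : X.Nonempty := by rw [← Set.ncard_pos hXfin]; omega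
  obtain ⟨a, ha⟩ := hne
  have haE := t.sub (hX ha)
  refine ⟨⟨hX, ?_, ?_⟩, ?_⟩
  · rw [restrict_indep_iff, contract_eq, h.con_indep he haE]
    rintro ⟨⟨-, hi⟩, -⟩
    have h1 := hi.eRk_eq_encard
    rw [encard_insert_of_notMem heX, ← hXfin.cast_ncard_eq, hc3, ← rk_cast h.fin] at h1
    have : rk M (insert e X) = 3 + 1 := by exact_mod_cast h1
    omega
  · intro D hD
    obtain ⟨w, hw, hwD⟩ := Set.not_subset.1 hD.2
    have hDw : D ⊆ X \ {w} := fun d hd => ⟨hD.1 hd, fun hh => hwD (hh ▸ hd)⟩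
    have h2 : (X \ {w}).ncard = 2 := by
      rw [Set.ncard_sdiff_singleton_of_mem hw, hc3]
    obtain ⟨p, q, hpq, heq⟩ := Set.ncard_eq_two.1 h2
    have hp : p ∈ X := (heq.symm.subset (by simp : p ∈ ({p, q} : Set α))).1
    have hq : q ∈ X := (heq.symm.subset (by simp : q ∈ ({p, q} : Set α))).1
    rw [restrict_indep_iff, contract_eq, h.con_indep he haE]
    refine ⟨⟨fun hh => heX (hD.1 hh), ?_⟩, hD.1.trans hX⟩
    refine (h.indep3 he t (hX hp) (hX hq) hpq).subset ?_
    rw [heq] at hDw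
    exact insert_subset_insert hDw
  · rw [← hXfin.cast_ncard_eq, hc3]; rfl

theorem stmt8 (M : Matroid α) (hI4 : InternallyFourConnected M) (hB : Binary M)
    (h3 : EveryElementInThreeTriangles M) (hE : (14 : ℕ∞) ≤ M.E.encard)
    (hno4 : ¬ ∃ C, Cocircuit M C ∧ C.encard = 4)
    (hseq : ∀ X Y, IsExact4Separation M X Y → fcl M X = M.E ∨ fcl M Y = M.E) :
    ∀ e ∈ M.E, ∀ N, IsSimplificationOf N (contract M {e}) →
      InternallyFourConnected N ∧ ∀ T, ¬ IsTriad N T := by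
  obtain ⟨φ, hφ⟩ := hB
  have hrep : Rep M φ := hφ
  have hpair : ∀ x ∈ M.E, ∀ y ∈ M.E, x ≠ y → M.Indep {x, y} :=
    fun x hx y hy hxy => pair_indep hI4.1 hE hx hy hxy
  have hfin : M.E.Finite := by
    have htop := rank_fin hI4.1 hE
    obtain ⟨n, hn⟩ := ENat.ne_top_iff_exists.1 htop
    have h1 := hrep.span_card (n := n) subset_rfl hn.symm.le
    have h2 : ((Submodule.span (ZMod 2) (φ '' M.E) : Submodule (ZMod 2) (VV α)) :
      Set (VV α)).Finite := finite_of_encard_le_coe h1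
    refine Set.Finite.of_finite_image (h2.subset Submodule.subset_span) ?_
    intro x hx y hy hxy
    by_contra hne
    have h3 := (hrep {x, y} (by rintro z (rfl | rfl) <;> assumption)).1 (hpair x hx y hy hne)
    exact hne (h3.injOn (by simp) (by simp) hxy)
  have h : Good M φ := ⟨hrep, hpair, hfin⟩
  rintro e he N ⟨S, hS, rfl, -, hu⟩
  have t : Tr M e S := h.tr he hS hu
  have hS7 := h.cardS hE he t
  have hSfin : S.Finite := h.fin.subset (t.sub.trans sdiff_subset)
  obtain ⟨a, ha⟩ : S.Nonempty := by rw [← Set.ncard_pos hSfin]; omega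
  have haE := t.sub ha
  set N := contract M {e} ↾ S with hN
  have hNE : N.E = S := rfl
  have hrkN : ∀ X ⊆ S, eRank N X + 1 = rk M (insert e X) :=
    fun X hX => h.con_rk he haE hX t.sub
  have hrkS : rk M (insert e S) = rk M M.E := by
    refine (cl_rk h.fin (insert_subset he (t.sub.trans sdiff_subset)) ?_).symm
    intro f hf
    have hSE : insert e S ⊆ M.E := insert_subset he (t.sub.trans sdiff_subset)
    by_cases hfe : f = e
    · subst hfe; exact M.subset_closure _ hSE (by simp)
    · obtain ⟨s, hs, hfs⟩ := t.ex f ⟨hf, hfe⟩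
      refine M.closure_subset_closure ?_ hfs
      rintro w (rfl | rfl)
      · exact Or.inr hs
      · exact Or.inl rfl
  have hconv : ∀ k : ℕ, 1 ≤ k → k ≤ 3 → ∀ X Y, IsKSeparation N k X Y →
      X ⊆ S ∧ Y ⊆ S ∧ (rk M (insert e X) ≤ k ∨ rk M (insert e Y) ≤ k) := by
    rintro k hk1 hk3 X Y ⟨hdj, hun, hle, -, -⟩
    rw [hNE] at hun
    have hXS : X ⊆ S := hun ▸ subset_union_left
    have hYS : Y ⊆ S := hun ▸ subset_union_right
    refine ⟨hXS, hYS, h.sepN h3 hno4 hI4 hseq he t hdj hun hk1 hk3 ?_⟩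
    have h1 := hrkN X hXS
    have h2 := hrkN Y hYS
    have h4 := hrkN S subset_rfl
    rw [hrkS] at h4
    have hle' : eRank N X + eRank N Y ≤ eRank N S + ((k - 1 : ℕ) : ℕ∞) := hle
    have h5 : ((rk M (insert e X) + rk M (insert e Y) : ℕ) : ℕ∞) ≤ ((rk M M.E + k : ℕ) : ℕ∞) := by
      push_cast
      rw [← h1, ← h2, ← h4]
      have hkk : (k : ℕ∞) = ((k - 1 : ℕ) : ℕ∞) + 1 := by
        exact_mod_cast (by omega)
      rw [hkk]
      calc eRank N X + 1 + (eRank N Y + 1) = (eRank N X + eRank N Y) + (1 + 1) := by ring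
        _ ≤ (eRank N S + ((k - 1 : ℕ) : ℕ∞)) + (1 + 1) := by gcongr
        _ = _ := by ring
    exact_mod_cast h5
  have hsmall : ∀ k : ℕ, 1 ≤ k → k < 3 → ∀ X ⊆ S, (k : ℕ∞) ≤ X.encard →
      ¬ rk M (insert e X) ≤ k := by
    intro k hk1 hk3 X hX hc hle
    have hXfin := hSfin.subset hX
    rw [← hXfin.cast_ncard_eq] at hc
    have hc' : k ≤ X.ncard := by exact_mod_cast hc
    have hle2 : M.eRk (insert e X) ≤ k := by
      rw [← rk_cast h.fin]; exact_mod_cast hle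
    by_cases hX1 : 1 < X.ncard
    · obtain ⟨x, hx, y, hy, hxy⟩ := (Set.one_lt_ncard hXfin).1 hX1
      have hi := h.indep3 he t (hX hx) (hX hy) hxy
      have h1 := hi.encard_le_eRk_of_subset (X := insert e X)
        (insert_subset_insert (by rintro z (rfl | rfl) <;> assumption))
      have h2 : ({e, x, y} : Set α).encard = 3 := encard_eq_three.2
        ⟨e, x, y, fun hh => (t.sub (hX hx)).2 hh.symm, fun hh => (t.sub (hX hy)).2 hh.symm, hxy, rfl⟩
      rw [h2] at h1
      have h4 : (3 : ℕ∞) ≤ k := h1.trans hle2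
      have : 3 ≤ k := by exact_mod_cast h4
      omega
    · obtain ⟨x, hx⟩ : X.Nonempty := by rw [← Set.ncard_pos hXfin]; omega
      have hxE := t.sub (hX hx)
      have hne : e ≠ x := fun hh => hxE.2 hh.symm
      have hi := h.pair e he x hxE.1 hne
      have h1 := hi.encard_le_eRk_of_subset (X := insert e X)
        (insert_subset_insert (by simpa using hx))
      rw [encard_pair hne] at h1
      have h4 : (2 : ℕ∞) ≤ k := h1.trans hle2
      have : 2 ≤ k := by exact_mod_cast h4
      omega
  have hconn : NConnected N 3 := by
    intro k hk1 hk3 X Y hs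
    obtain ⟨hX, hY, hor⟩ := hconv k hk1 (by omega) X Y hs
    rcases hor with h1 | h1
    · exact hsmall k hk1 hk3 X hX hs.2.2.2.1 h1
    · exact hsmall k hk1 hk3 Y hY hs.2.2.2.2 h1
  refine ⟨⟨hconn, ?_⟩, ?_⟩
  · intro X Y hs
    obtain ⟨hX, hY, hor⟩ := hconv 3 (by omega) le_rfl X Y hs
    rcases hor with h1 | h1
    · exact Or.inl (h.triN he t hX h1 hs.2.2.2.1)
    · exact Or.inr (Or.inr (Or.inl (h.triN he t hY h1 hs.2.2.2.2)))
  · rintro T ⟨⟨hTE, hTd, -⟩, hT3⟩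
    have hTS : T ⊆ S := hTE
    have hTfin := hSfin.subset hTS
    have hTn : T.ncard = 3 := by
      rw [← hTfin.cast_ncard_eq] at hT3
      exact_mod_cast hT3
    have hST : (S \ T).ncard = S.ncard - 3 := by
      rw [Set.ncard_sdiff hTS hTfin, hTn]
    have hSTc : ((S \ T).ncard : ℕ∞) = (S \ T).encard := (hSfin.subset sdiff_subset).cast_ncard_eq
    have hns : ¬ N.Spanning (S \ T) := fun hsp =>
      hTd ((coindep_iff_compl_spanning (M := N) hTS).2 hsp)
    have hlt : rk M (insert e (S \ T)) + 1 ≤ rk M M.E := by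
      rw [spanning_iff_ground_subset_closure (M := N) (S := S \ T) sdiff_subset, Set.not_subset] at hns
      obtain ⟨z, hz, hzc⟩ := hns
      have h1 := N.eRk_insert_eq_add_one (e := z) (X := S \ T) ⟨hz, hzc⟩
      have h2 : N.eRk (insert z (S \ T)) ≤ N.eRk S := N.eRk_mono (insert_subset hz sdiff_subset)
      rw [h1, ← eRank_eq, ← eRank_eq] at h2
      have h4 := hrkN S subset_rfl
      have h5 := hrkN (S \ T) sdiff_subset
      rw [hrkS] at h4
      have h6 : ((rk M (insert e (S \ T)) + 1 : ℕ) : ℕ∞) ≤ (rk M M.E : ℕ) := by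
        push_cast
        rw [← h4, ← h5]
        gcongr
      exact_mod_cast h6
    have hmk : ∀ k : ℕ, 1 ≤ k → k ≤ 3 →
        rk M (insert e T) + rk M (insert e (S \ T)) ≤ rk M M.E + k →
        IsKSeparation N k T (S \ T) := by
      intro k hk1 hk3 hle
      refine ⟨disjoint_sdiff_right, union_sdiff_cancel hTS, ?_, ?_, ?_⟩
      · have h1 := hrkN T hTS
        have h2 := hrkN (S \ T) sdiff_subset
        have h4 := hrkN S subset_rfl
        rw [hrkS] at h4
        change eRank N T + eRank N (S \ T) ≤ eRank N S + ((k - 1 : ℕ) : ℕ∞)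
        have h5 : ((rk M (insert e T) + rk M (insert e (S \ T)) : ℕ) : ℕ∞) ≤
          ((rk M M.E + k : ℕ) : ℕ∞) := by exact_mod_cast hle
        push_cast at h5
        rw [← h1, ← h2, ← h4] at h5
        have hkk : (k : ℕ∞) = ((k - 1 : ℕ) : ℕ∞) + 1 := by
          exact_mod_cast (by omega)
        rw [hkk] at h5
        have h6 : (eRank N T + eRank N (S \ T)) + 2 ≤
            (eRank N S + ((k - 1 : ℕ) : ℕ∞)) + 2 := by
          calc _ = eRank N T + 1 + (eRank N (S \ T) + 1) := by ring
            _ ≤ _ := h5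
            _ = _ := by ring
        exact (ENat.add_le_add_iff_right (by simp)).1 h6
      · rw [hT3]; exact_mod_cast hk3
      · rw [← hSTc]; exact_mod_cast (by omega)
    have hT4 : rk M (insert e T) ≤ 4 := by
      have h1 := M.eRk_le_encard (insert e T)
      have h2 := encard_insert_le T e
      rw [hT3] at h2
      have h4 := h1.trans h2
      rw [← rk_cast h.fin] at h4
      have h5 : ((rk M (insert e T) : ℕ) : ℕ∞) ≤ ((4 : ℕ) : ℕ∞) := by
        refine h4.trans ?_
        norm_num
      exact_mod_cast h5
    obtain ⟨-, -, hor⟩ := hconv 3 (by omega) le_rfl _ _ (hmk 3 (by omega) le_rfl (by omega))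
    rcases hor with h1 | h1
    · exact hconn 2 (by omega) (by omega) _ _ (hmk 2 (by omega) (by omega) (by omega))
    · have := h.card3 he t sdiff_subset h1
      omega

end Paper
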